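/- Let β' ∈ Φ⁺ be a positive root and i an index such that β := s_i(β') satisfies β − β' ∈ ℝ_{>0}·α_i. Then the set of shards of β^⊥ equals the set of those cones σ_i⁺(K') and σ_i⁻(K'), as K' ranges over the shards of (β')^⊥, whose linear span in V* has dimension n − 1. -/

import Mathlib

/-!
Setup: a symmetrizable crystallographic Cartan matrix `A` with symmetrizers `d`,
the vector space `V = Fin n → ℝ` with standard basis `α i = Pi.single i 1`,
the bilinear form `(α i, α j) = d i * A i j`, the simple reflections
`s i (x) = x - (dᵢ⁻¹ αᵢ, x) αᵢ`, the group `W` generated by them (elements of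
which are represented as products of lists of simple reflections), and the
set of real roots `Φ = { w (α i) }`.
-/

open Finset

noncomputable section

/-- The simple root `α i`, i.e. the `i`-th standard basis vector of `ℝⁿ`. -/
def sroot (n : ℕ) (i : Fin n) : Fin n → ℝ := Pi.single i 1

/-- The symmetric bilinear form with `(α i, α j) = d i * A i j`. -/
def formL (n : ℕ) (d : Fin n → ℤ) (A : Fin n → Fin n → ℤ) :
    (Fin n → ℝ) →ₗ[ℝ] (Fin n → ℝ) →ₗ[ℝ] ℝ :=
  ∑ i : Fin n, ∑ j : Fin n,
    ((d i * A i j : ℤ) : ℝ) •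
      LinearMap.smulRight (LinearMap.proj i : (Fin n → ℝ) →ₗ[ℝ] ℝ)
        (LinearMap.proj j : (Fin n → ℝ) →ₗ[ℝ] ℝ)

/-- The simple reflection `s i`, given by `s i x = x - (dᵢ⁻¹ • αᵢ, x) • αᵢ`. -/
def simpleRefl (n : ℕ) (d : Fin n → ℤ) (A : Fin n → Fin n → ℤ) (i : Fin n) :
    Module.End ℝ (Fin n → ℝ) :=
  LinearMap.id - ((d i : ℝ)⁻¹) • (formL n d A (sroot n i)).smulRight (sroot n i)

/-- The element `s i_r * ⋯ * s i_1` of `W` corresponding to the list `l = [i_1, …, i_r]`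
(the reflection `s i_1` is applied first). -/
def wprod (n : ℕ) (d : Fin n → ℤ) (A : Fin n → Fin n → ℤ) (l : List (Fin n)) :
    Module.End ℝ (Fin n → ℝ) :=
  ((l.map (simpleRefl n d A)).reverse).prod

/-- `β` is a real root: `β = w (α i)` for some `w ∈ W` and some `i`. -/
def IsRoot (n : ℕ) (d : Fin n → ℤ) (A : Fin n → Fin n → ℤ) (β : Fin n → ℝ) : Prop :=
  ∃ (l : List (Fin n)) (i : Fin n), β = wprod n d A l (sroot n i)

/-- `β` is a positive root: a real root all of whose coordinates are `≥ 0`. -/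
def IsPosRoot (n : ℕ) (d : Fin n → ℤ) (A : Fin n → Fin n → ℤ) (β : Fin n → ℝ) : Prop :=
  IsRoot n d A β ∧ ∀ k, 0 ≤ β k

/-- `β` is a negative root: a real root all of whose coordinates are `≤ 0`. -/
def IsNegRoot (n : ℕ) (d : Fin n → ℤ) (A : Fin n → Fin n → ℤ) (β : Fin n → ℝ) : Prop :=
  IsRoot n d A β ∧ ∀ k, β k ≤ 0

/-- The reflection `t_β` along a root `β`: `t_β x = x - (β^∨, x) • β` where
`β^∨ = d_β⁻¹ • β` and `d_β = (β, β)/2`. -/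
def reflAlong (n : ℕ) (d : Fin n → ℤ) (A : Fin n → Fin n → ℤ) (β : Fin n → ℝ) :
    Module.End ℝ (Fin n → ℝ) :=
  LinearMap.id - (2 / formL n d A β β) • (formL n d A β).smulRight β

/-- `R` is a rank two subsystem: `R = Φ ∩ L` for a two-dimensional subspace `L`
which is spanned by `R`. -/
def IsRankTwo (n : ℕ) (d : Fin n → ℤ) (A : Fin n → Fin n → ℤ)
    (R : Set (Fin n → ℝ)) : Prop :=
  ∃ L : Submodule ℝ (Fin n → ℝ), Module.finrank ℝ L = 2 ∧
    R = {γ | IsRoot n d A γ} ∩ (L : Set (Fin n → ℝ)) ∧ Submodule.span ℝ R = L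

/-- `β` is a fundamental root of `R`: it is a positive root of `R` and there is a
second positive root `β'` of `R` such that every positive root of `R` is a
nonnegative combination of `β` and `β'`. -/
def IsFundamentalIn (n : ℕ) (d : Fin n → ℤ) (A : Fin n → Fin n → ℤ)
    (R : Set (Fin n → ℝ)) (β : Fin n → ℝ) : Prop :=
  β ∈ R ∧ IsPosRoot n d A β ∧
    ∃ β' ∈ R, IsPosRoot n d A β' ∧ β' ≠ β ∧
      ∀ γ ∈ R, IsPosRoot n d A γ →
        ∃ c c' : ℝ, 0 ≤ c ∧ 0 ≤ c' ∧ γ = c • β + c' • β'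

/-- The rank two subsystem `R` cuts `β^⊥`: `β ∈ R` but `β` is not a fundamental
root of `R`. -/
def CutsPerp (n : ℕ) (d : Fin n → ℤ) (A : Fin n → Fin n → ℤ)
    (R : Set (Fin n → ℝ)) (β : Fin n → ℝ) : Prop :=
  IsRankTwo n d A R ∧ β ∈ R ∧ ¬ IsFundamentalIn n d A R β

/-! The dual space `V*` is also modelled as `Fin n → ℝ`, via the pairing
`⟨θ, x⟩ = ∑ i, θ i * x i`; thus `θ (α i) = θ i`.  The contragredient action of a
simple reflection `s i` on `θ ∈ V*` (characterized by `⟨s i • θ, s i x⟩ = ⟨θ, x⟩`,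
using `s i⁻¹ = s i`) is the functional `x ↦ ⟨θ, s i x⟩`, whose coordinates are
computed on the standard basis. -/

/-- The contragredient (dual) action of the simple reflection `s i` on `V*`. -/
def dualRefl (n : ℕ) (d : Fin n → ℤ) (A : Fin n → Fin n → ℤ) (i : Fin n)
    (θ : Fin n → ℝ) : Fin n → ℝ :=
  fun j => ∑ k, θ k * (simpleRefl n d A i (sroot n j)) k

/-- For `S ⊆ V`, the subspace `S^⊥ = {θ ∈ V* : ⟨θ, x⟩ = 0 for all x ∈ S}`. -/
def perpSet (n : ℕ) (S : Set (Fin n → ℝ)) : Set (Fin n → ℝ) :=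
  {θ | ∀ x ∈ S, ∑ i, θ i * x i = 0}

/-- The hyperplane `β^⊥ ⊆ V*`. -/
def hyperplane (n : ℕ) (β : Fin n → ℝ) : Set (Fin n → ℝ) :=
  {θ | ∑ i, θ i * β i = 0}

/-- The complement, inside `β^⊥`, of the union of the subspaces `R^⊥` over all rank
two subsystems `R` cutting `β^⊥`. -/
def shardComplement (n : ℕ) (d : Fin n → ℤ) (A : Fin n → Fin n → ℤ)
    (β : Fin n → ℝ) : Set (Fin n → ℝ) :=
  hyperplane n β \ ⋃ R ∈ {R | CutsPerp n d A R β}, perpSet n R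

/-- `K` is a shard of `β^⊥`: the closure of a connected component of
`β^⊥ ∖ ⋃_{R cuts β^⊥} R^⊥`.  (Since this set lies in the closed hyperplane `β^⊥`,
closures taken in `β^⊥` and in `V*` agree.) -/
def IsShard (n : ℕ) (d : Fin n → ℤ) (A : Fin n → Fin n → ℤ)
    (β : Fin n → ℝ) (K : Set (Fin n → ℝ)) : Prop :=
  ∃ θ ∈ shardComplement n d A β,
    K = closure (connectedComponentIn (shardComplement n d A β) θ)

/-- The operation `σ i^ε`: for `ε = true` (resp. `false`), intersect with the closed
halfspace `θ (α i) ≥ 0` (resp. `≤ 0`) and apply `s i`. -/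
def sigmaOp (n : ℕ) (d : Fin n → ℤ) (A : Fin n → Fin n → ℤ) (i : Fin n) (ε : Bool)
    (K : Set (Fin n → ℝ)) : Set (Fin n → ℝ) :=
  dualRefl n d A i '' (K ∩ {θ | if ε then 0 ≤ θ i else θ i ≤ 0})

/-- The standing hypotheses. -/
structure GoodC (n : ℕ) (d : Fin n → ℤ) (A : Fin n → Fin n → ℤ) : Prop where
  hd : ∀ i, 0 < d i
  hdiag : ∀ i, A i i = 2
  hoff : ∀ i j, i ≠ j → A i j ≤ 0
  hsym : ∀ i j, d i * A i j = d j * A j i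

/-- The simple coroot as a functional. -/
def fco (n : ℕ) (A : Fin n → Fin n → ℤ) (i : Fin n) : (Fin n → ℝ) →ₗ[ℝ] ℝ :=
  ∑ j : Fin n, (A i j : ℝ) • LinearMap.proj j

section helpers

variable {n : ℕ} {d : Fin n → ℤ} {A : Fin n → Fin n → ℤ}

lemma fco_sroot (i j : Fin n) : fco n A i (sroot n j) = A i j := by
  simp [fco, sroot, LinearMap.sum_apply, Pi.single_apply]

lemma form_apply (x y : Fin n → ℝ) :
    formL n d A x y = ∑ i, ∑ j, ((d i : ℝ) * A i j) * (x i * y j) := by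
  simp [formL, LinearMap.sum_apply]

lemma form_sroot (i : Fin n) (y : Fin n → ℝ) :
    formL n d A (sroot n i) y = d i * fco n A i y := by
  rw [form_apply]
  simp [sroot, fco, LinearMap.sum_apply, Pi.single_apply, Finset.mul_sum, mul_assoc]

lemma form_comm (h : GoodC n d A) (x y : Fin n → ℝ) :
    formL n d A x y = formL n d A y x := by
  rw [form_apply, form_apply, Finset.sum_comm]
  refine Finset.sum_congr rfl fun i _ => Finset.sum_congr rfl fun j _ => ?_
  have : ((d j : ℝ) * A j i) = d i * A i j := by exact_mod_cast h.hsym j i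
  rw [this]; ring

lemma refl_apply (h : GoodC n d A) (i : Fin n) (x : Fin n → ℝ) :
    simpleRefl n d A i x = x - fco n A i x • sroot n i := by
  have : (d i : ℝ) ≠ 0 := by exact_mod_cast (h.hd i).ne'
  simp only [simpleRefl, LinearMap.sub_apply, LinearMap.id_apply, LinearMap.smul_apply,
    LinearMap.smulRight_apply, form_sroot, smul_smul]
  rw [← mul_assoc, inv_mul_cancel₀ this, one_mul]

lemma refl_sroot (h : GoodC n d A) (i : Fin n) :
    simpleRefl n d A i (sroot n i) = - sroot n i := by
  rw [refl_apply h, fco_sroot, h.hdiag]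
  push_cast
  rw [two_smul]; abel

lemma refl_refl (h : GoodC n d A) (i : Fin n) (x : Fin n → ℝ) :
    simpleRefl n d A i (simpleRefl n d A i x) = x := by
  rw [refl_apply h i x, map_sub, map_smul, refl_sroot h, refl_apply h i x]
  simp

lemma refl_mul_self (h : GoodC n d A) (i : Fin n) :
    simpleRefl n d A i * simpleRefl n d A i = 1 := by
  ext1 x
  ext1
  simp [refl_refl h]

lemma refl_form (h : GoodC n d A) (i : Fin n) (x y : Fin n → ℝ) :
    formL n d A (simpleRefl n d A i x) y = formL n d A x (simpleRefl n d A i y) := by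
  rw [refl_apply h, refl_apply h]
  simp only [map_sub, map_smul, LinearMap.sub_apply, LinearMap.smul_apply, smul_eq_mul]
  rw [form_sroot, form_comm h x (sroot n i), form_sroot]; ring

lemma refl_coord (h : GoodC n d A) (i k : Fin n) (hk : k ≠ i) (x : Fin n → ℝ) :
    simpleRefl n d A i x k = x k := by
  rw [refl_apply h]
  simp [sroot, Pi.single_apply, hk]

lemma wprod_nil : wprod n d A [] = 1 := by simp [wprod]

lemma wprod_cons (i : Fin n) (l : List (Fin n)) :
    wprod n d A (i :: l) = wprod n d A l * simpleRefl n d A i := by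
  simp [wprod]

lemma wprod_append (l l' : List (Fin n)) :
    wprod n d A (l ++ l') = wprod n d A l' * wprod n d A l := by
  simp [wprod]

/-! Length -/

/-- length of an element -/
def wlen (n : ℕ) (d : Fin n → ℤ) (A : Fin n → Fin n → ℤ) (w : Module.End ℝ (Fin n → ℝ)) : ℕ :=
  sInf {N | ∃ l : List (Fin n), wprod n d A l = w ∧ l.length = N}

lemma wlen_le (l : List (Fin n)) : wlen n d A (wprod n d A l) ≤ l.length :=
  Nat.sInf_le ⟨l, rfl, rfl⟩

lemma wlen_exists (l : List (Fin n)) :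
    ∃ l', wprod n d A l' = wprod n d A l ∧ l'.length = wlen n d A (wprod n d A l) :=
  Nat.sInf_mem (s := {N | ∃ l' : List (Fin n), wprod n d A l' = wprod n d A l ∧ l'.length = N})
    ⟨_, l, rfl, rfl⟩

/-- alternating word of length `k`, whose first letter is `t` (then `s`, ...). -/
def altw {n : ℕ} (t s : Fin n) : ℕ → List (Fin n)
  | 0 => []
  | (k+1) => t :: altw s t k

lemma altw_length (k : ℕ) : ∀ (t s : Fin n), (altw t s k).length = k := by
  induction k with
  | zero => intros; rfl
  | succ k ih => intro t s; simp [altw, ih]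

/-- the last letter choice -/
lemma altw_succ (k : ℕ) : ∀ (t s : Fin n),
    altw t s (k+1) = altw t s k ++ [if Even k then t else s] := by
  induction k with
  | zero => intros; simp [altw]
  | succ k ih =>
    intro t s
    rw [altw, ih s t]
    by_cases hk : Even k <;> simp [altw, hk, Nat.even_add_one]

lemma braid_aux (h : GoodC n d A) {s t : Fin n} (hst : s ≠ t) (k : ℕ)
    (hab : (A s t = 0 ∧ A t s = 0 ∧ k = 2) ∨ (A s t = -1 ∧ A t s = -1 ∧ k = 3) ∨
      (A s t = -1 ∧ A t s = -2 ∧ k = 4) ∨ (A s t = -2 ∧ A t s = -1 ∧ k = 4) ∨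
      (A s t = -1 ∧ A t s = -3 ∧ k = 6) ∨ (A s t = -3 ∧ A t s = -1 ∧ k = 6)) :
    wprod n d A (altw t s k) = wprod n d A (altw s t k) := by
  apply LinearMap.ext
  intro x
  rcases hab with ⟨h1, h2, rfl⟩ | ⟨h1, h2, rfl⟩ | ⟨h1, h2, rfl⟩ | ⟨h1, h2, rfl⟩ | ⟨h1, h2, rfl⟩ |
    ⟨h1, h2, rfl⟩ <;>
  · simp only [altw, wprod_cons, wprod_nil, one_mul, Module.End.mul_apply, refl_apply h, map_sub,
      map_smul, fco_sroot, h1, h2, h.hdiag, smul_eq_mul]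
    push_cast
    module

/-- the rank two sign computation. `altw t s k` applied to `α_s` is a nonneg combination. -/
lemma rank_two_big (h : GoodC n d A) {s t : Fin n} (hst : s ≠ t) (hc : 4 ≤ A s t * A t s) (k : ℕ) :
    ∃ x y : ℝ, 0 ≤ x ∧ 0 ≤ y ∧ wprod n d A (altw t s k) (sroot n s) = x • sroot n s + y • sroot n t
      ∧ (Even k → 2 * y ≤ (-A t s) * x) ∧ (¬ Even k → 2 * x ≤ (-A s t) * y) := by
  have hs : (A s t : ℝ) ≤ 0 := by exact_mod_cast h.hoff s t hst
  have ht : (A t s : ℝ) ≤ 0 := by exact_mod_cast h.hoff t s hst.symm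
  have hc' : (4:ℝ) ≤ A s t * A t s := by exact_mod_cast hc
  induction k with
  | zero =>
    refine ⟨1, 0, by norm_num, le_rfl, by simp [altw, wprod_nil], ?_, ?_⟩
    · intro; simpa using ht
    · intro h; simp at h
  | succ k ih =>
    obtain ⟨x, y, hx, hy, he, h1, h2⟩ := ih
    rw [altw_succ, wprod_append, wprod_cons, wprod_nil, one_mul, Module.End.mul_apply, he]
    by_cases hk : Even k
    · have h1 := h1 hk
      refine ⟨x, -y - A t s * x, hx, by linarith, ?_, ?_, ?_⟩
      · simp only [hk, if_true, refl_apply h, map_add, map_smul, fco_sroot, h.hdiag, smul_eq_mul]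
        push_cast
        module
      · intro h; exact absurd hk (Nat.even_add_one.1 h)
      · intro _
        nlinarith [mul_nonneg hx (sub_nonneg.2 hc'), mul_nonneg (neg_nonneg.2 hs) (sub_nonneg.2 h1)]
    · have h2 := h2 hk
      refine ⟨-x - A s t * y, y, by linarith, hy, ?_, ?_, ?_⟩
      · simp only [hk, if_false, refl_apply h, map_add, map_smul, fco_sroot, h.hdiag, smul_eq_mul]
        push_cast
        module
      · intro _
        nlinarith [mul_nonneg hy (sub_nonneg.2 hc'), mul_nonneg (neg_nonneg.2 ht) (sub_nonneg.2 h2)]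
      · intro h; exact absurd (Nat.even_add_one.2 hk) h

lemma rank_two_small (h : GoodC n d A) {s t : Fin n} (m k : ℕ) (hkm : k < m)
    (hab : (A s t = 0 ∧ A t s = 0 ∧ m = 2) ∨ (A s t = -1 ∧ A t s = -1 ∧ m = 3) ∨
      (A s t = -1 ∧ A t s = -2 ∧ m = 4) ∨ (A s t = -2 ∧ A t s = -1 ∧ m = 4) ∨
      (A s t = -1 ∧ A t s = -3 ∧ m = 6) ∨ (A s t = -3 ∧ A t s = -1 ∧ m = 6)) :
    ∃ x y : ℕ, wprod n d A (altw t s k) (sroot n s)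
      = (x : ℝ) • sroot n s + (y : ℝ) • sroot n t := by
  rcases hab with ⟨h1, h2, rfl⟩ | ⟨h1, h2, rfl⟩ | ⟨h1, h2, rfl⟩ | ⟨h1, h2, rfl⟩ | ⟨h1, h2, rfl⟩ |
    ⟨h1, h2, rfl⟩ <;> interval_cases k <;>
  simp only [altw, wprod_cons, wprod_nil, one_mul, Module.End.mul_apply, refl_apply h, map_sub,
      map_smul, fco_sroot, h1, h2, h.hdiag, smul_eq_mul, Module.End.one_apply] <;>
  first
  | exact ⟨1, 0, by push_cast; module⟩
  | exact ⟨1, 1, by push_cast; module⟩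
  | exact ⟨0, 1, by push_cast; module⟩
  | exact ⟨1, 2, by push_cast; module⟩
  | exact ⟨2, 1, by push_cast; module⟩
  | exact ⟨1, 3, by push_cast; module⟩
  | exact ⟨2, 3, by push_cast; module⟩

lemma cases_ab (h : GoodC n d A) {s t : Fin n} (hst : s ≠ t) (hc : A s t * A t s < 4) :
    ∃ m, (A s t = 0 ∧ A t s = 0 ∧ m = 2) ∨ (A s t = -1 ∧ A t s = -1 ∧ m = 3) ∨
      (A s t = -1 ∧ A t s = -2 ∧ m = 4) ∨ (A s t = -2 ∧ A t s = -1 ∧ m = 4) ∨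
      (A s t = -1 ∧ A t s = -3 ∧ m = 6) ∨ (A s t = -3 ∧ A t s = -1 ∧ m = 6) := by
  have h1 := h.hoff s t hst
  have h2 := h.hoff t s hst.symm
  have h3 := h.hsym s t
  have ds := h.hd s
  have dt := h.hd t
  by_cases a0 : A s t = 0
  · rw [a0, mul_zero] at h3
    have : A t s = 0 := by
      rcases mul_eq_zero.1 h3.symm with h | h
      · omega
      · exact h
    exact ⟨2, Or.inl ⟨a0, this, rfl⟩⟩
  have b0 : A t s ≠ 0 := by
    intro h; rw [h, mul_zero] at h3
    rcases mul_eq_zero.1 h3 with h | h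
    · omega
    · exact a0 h
  have ha : -3 ≤ A s t := by
    by_contra hh
    push Not at hh
    nlinarith [show A t s ≤ -1 by omega]
  have hb : -3 ≤ A t s := by
    by_contra hh
    push Not at hh
    nlinarith [show A s t ≤ -1 by omega]
  generalize A s t = a at *
  generalize A t s = b at *
  interval_cases a <;> interval_cases b <;> simp_all

lemma len_refl_ge (h : GoodC n d A) : ∀ N : ℕ, ∀ l : List (Fin n),
    wlen n d A (wprod n d A l) = N → ∀ s : Fin n,
    N ≤ wlen n d A (wprod n d A (s :: l)) → ∀ k, 0 ≤ wprod n d A l (sroot n s) k := by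
  intro N
  induction N using Nat.strong_induction_on with
  | _ N IH =>
  intro l hl s hs
  -- largest k
  let Q : ℕ → Prop := fun k => ∃ t, t ≠ s ∧ ∃ v : List (Fin n),
    wprod n d A (altw t s k ++ v) = wprod n d A l ∧ v.length + k = N
  by_cases hN : N = 0
  · obtain ⟨l', h1, h2⟩ := wlen_exists (d := d) (A := A) l
    rw [hl, hN] at h2
    rw [List.length_eq_zero_iff] at h2
    subst h2
    rw [← h1, wprod_nil]
    intro k
    simp only [sroot, Module.End.one_apply, Pi.single_apply]
    split_ifs <;> norm_num
  obtain ⟨l', h1, h2⟩ := wlen_exists (d := d) (A := A) l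
  rw [hl] at h2
  cases l' with
  | nil => simp at h2; omega
  | cons t l1 =>
  have hts : t ≠ s := by
    rintro rfl
    rw [wprod_cons, ← h1, wprod_cons, mul_assoc, refl_mul_self h, mul_one] at hs
    have := wlen_le (d := d) (A := A) l1
    simp at h2
    omega
  let Q : ℕ → Prop := fun k => ∃ v : List (Fin n),
    wprod n d A (altw t s k ++ v) = wprod n d A l ∧ v.length + k = N
  have hQ1 : Q 1 := ⟨l1, by simpa [altw] using h1, by simpa using h2⟩
  have hQb : ∀ k, Q k → k ≤ N := by rintro k ⟨v, _, h⟩; omega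
  classical
  obtain ⟨k, hk1, hQk, hmax⟩ : ∃ k, 1 ≤ k ∧ Q k ∧ ¬ Q (k+1) := by
    by_contra hcon
    push Not at hcon
    have : ∀ k, Q (k+1) := by
      intro k
      induction k with
      | zero => exact hQ1
      | succ k ih => exact hcon _ (by omega) ih
    have := hQb _ (this N)
    omega
  obtain ⟨v, hv, hvN⟩ := hQk
  -- v is reduced
  have hvlen : wlen n d A (wprod n d A v) = v.length := by
    refine le_antisymm (wlen_le v) ?_
    obtain ⟨v', hv1, hv2⟩ := wlen_exists (d := d) (A := A) v
    rw [← hv2]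
    have := wlen_le (d := d) (A := A) (altw t s k ++ v')
    rw [wprod_append, hv1, ← wprod_append, hv, hl, List.length_append, altw_length] at this
    omega
  -- the two ascents
  have asc1 : ∀ r, r = (if Even k then t else s) → v.length ≤ wlen n d A (wprod n d A (r :: v)) := by
    intro r hr
    by_contra hcon
    push Not at hcon
    obtain ⟨v', hv1, hv2⟩ := wlen_exists (d := d) (A := A) (r :: v)
    apply hmax
    have e : wprod n d A (altw t s (k+1) ++ v') = wprod n d A l := by
      rw [altw_succ, ← hr, List.append_assoc, wprod_append, wprod_append, hv1, wprod_cons,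
        wprod_cons, wprod_nil, one_mul, mul_assoc (wprod n d A v), refl_mul_self h, mul_one,
        ← wprod_append, hv]
    refine ⟨v', e, ?_⟩
    have := wlen_le (d := d) (A := A) (altw t s (k+1) ++ v')
    rw [e, hl, List.length_append, altw_length] at this
    omega
  have asc2 : ∀ r, r = (if Even k then s else t) → v.length ≤ wlen n d A (wprod n d A (r :: v)) := by
    intro r hr
    by_contra hcon
    push Not at hcon
    obtain ⟨v', hv1, hv2⟩ := wlen_exists (d := d) (A := A) (r :: v)
    obtain ⟨j, rfl⟩ : ∃ j, k = j + 1 := ⟨k - 1, by omega⟩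
    have hr' : r = if Even j then t else s := by
      rw [hr]; by_cases hj : Even j <;> simp [Nat.even_add_one, hj]
    have e : wprod n d A (altw t s j ++ v') = wprod n d A l := by
      rw [wprod_append, hv1, ← hv, altw_succ, List.append_assoc, wprod_append, ← hr']
      rfl
    have := wlen_le (d := d) (A := A) (altw t s j ++ v')
    rw [e, hl, List.length_append, altw_length] at this
    omega
  have ascs : v.length ≤ wlen n d A (wprod n d A (s :: v)) := by
    by_cases hk : Even k
    · exact asc2 s (by simp [hk])
    · exact asc1 s (by simp [hk])
  have asct : v.length ≤ wlen n d A (wprod n d A (t :: v)) := by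
    by_cases hk : Even k
    · exact asc1 t (by simp [hk])
    · exact asc2 t (by simp [hk])
  have ps := IH v.length (by omega) v hvlen s ascs
  have pt := IH v.length (by omega) v hvlen t asct
  have fin : ∃ x y : ℝ, 0 ≤ x ∧ 0 ≤ y ∧
      wprod n d A (altw t s k) (sroot n s) = x • sroot n s + y • sroot n t := by
    by_cases hc : 4 ≤ A s t * A t s
    · obtain ⟨x, y, hx, hy, he, _⟩ := rank_two_big h hts.symm hc k
      exact ⟨x, y, hx, hy, he⟩
    · obtain ⟨m, hm⟩ := cases_ab h hts.symm (not_le.1 hc)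
      have hkm : k < m := by
        by_contra hcon
        push Not at hcon
        have hb := braid_aux h hts.symm m hm
        obtain ⟨j, rfl⟩ := Nat.exists_eq_add_of_le hcon
        obtain ⟨m', rfl⟩ : ∃ m', m = m' + 1 := ⟨m - 1, by omega⟩
        have hsplit : ∀ j, ∃ u : List (Fin n), u.length = j ∧
            altw t s (m' + 1 + j) = altw t s (m'+1) ++ u := by
          intro j
          induction j with
          | zero => exact ⟨[], rfl, by simp⟩
          | succ j ih =>
            obtain ⟨u, hu, he⟩ := ih
            refine ⟨u ++ [if Even (m'+1+j) then t else s], by simp [hu], ?_⟩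
            rw [← add_assoc, altw_succ, he, List.append_assoc]
        obtain ⟨u, hu, he⟩ := hsplit j
        have e : wprod n d A (s :: l) = wprod n d A (altw t s m' ++ (u ++ v)) := by
          rw [wprod_cons, ← hv, he, List.append_assoc, wprod_append, hb, altw, wprod_cons,
            mul_assoc, mul_assoc, refl_mul_self h, mul_one, ← wprod_append]
        have := wlen_le (d := d) (A := A) (altw t s m' ++ (u ++ v))
        rw [← e, List.length_append, altw_length, List.length_append] at this
        omega
      obtain ⟨x, y, he⟩ := rank_two_small h m k hkm hm
      exact ⟨x, y, by positivity, by positivity, he⟩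
  obtain ⟨x, y, hx, hy, he⟩ := fin
  intro j
  rw [← hv, wprod_append, Module.End.mul_apply, he, map_add, map_smul, map_smul]
  simp only [Pi.add_apply, Pi.smul_apply, smul_eq_mul]
  have := ps j
  have := pt j
  positivity

lemma sign_coh (h : GoodC n d A) {γ : Fin n → ℝ} (hγ : IsRoot n d A γ) :
    (∀ k, 0 ≤ γ k) ∨ (∀ k, γ k ≤ 0) := by
  obtain ⟨l, s, rfl⟩ := hγ
  rcases le_total (wlen n d A (wprod n d A l)) (wlen n d A (wprod n d A (s :: l))) with hh | hh
  · exact Or.inl (len_refl_ge h _ l rfl s hh)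
  · right
    have e : wprod n d A (s :: s :: l) = wprod n d A l := by
      rw [wprod_cons, wprod_cons, mul_assoc, refl_mul_self h, mul_one]
    have := len_refl_ge h _ (s :: l) rfl s (by rw [e]; exact hh)
    intro k
    have := this k
    rw [wprod_cons, Module.End.mul_apply, refl_sroot h, map_neg, Pi.neg_apply] at this
    linarith

end helpers

section helpers2

variable {n : ℕ} {d : Fin n → ℤ} {A : Fin n → Fin n → ℤ}

lemma root_wprod {γ : Fin n → ℝ} (hγ : IsRoot n d A γ) (l : List (Fin n)) :
    IsRoot n d A (wprod n d A l γ) := by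
  obtain ⟨l', s, rfl⟩ := hγ
  exact ⟨l' ++ l, s, by rw [wprod_append]; rfl⟩

lemma root_sroot (i : Fin n) : IsRoot n d A (sroot n i) := ⟨[], i, by simp [wprod_nil]⟩

lemma root_refl {γ : Fin n → ℝ} (hγ : IsRoot n d A γ) (i : Fin n) :
    IsRoot n d A (simpleRefl n d A i γ) := by
  have := root_wprod hγ [i]
  rwa [wprod_cons, wprod_nil, one_mul] at this

/-- reflections in real roots -/
lemma root_reflection (h : GoodC n d A) {γ : Fin n → ℝ} (hγ : IsRoot n d A γ) :
    ∃ (m : Fin n) (l : List (Fin n)), formL n d A γ γ = 2 * d m ∧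
      ∀ x, wprod n d A l x = x - ((d m : ℝ)⁻¹ * formL n d A γ x) • γ := by
  obtain ⟨l, m, rfl⟩ := hγ
  induction l using List.reverseRecOn with
  | nil =>
    refine ⟨m, [m], ?_, ?_⟩
    · rw [wprod_nil, Module.End.one_apply, form_sroot, fco_sroot, h.hdiag]; push_cast; ring
    · intro x
      have : (d m : ℝ) ≠ 0 := by exact_mod_cast (h.hd m).ne'
      rw [wprod_nil, Module.End.one_apply, form_sroot, wprod_cons, wprod_nil, one_mul,
        refl_apply h, ← mul_assoc, inv_mul_cancel₀ this, one_mul]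
  | append_singleton l i ih =>
    obtain ⟨m', l', h1, h2⟩ := ih
    have e : wprod n d A (l ++ [i]) (sroot n m)
        = simpleRefl n d A i (wprod n d A l (sroot n m)) := by
      rw [wprod_append, wprod_cons, wprod_nil, one_mul, Module.End.mul_apply]
    rw [e]
    generalize wprod n d A l (sroot n m) = γ at *
    refine ⟨m', [i] ++ l' ++ [i], ?_, ?_⟩
    · rw [refl_form h, refl_refl h, h1]
    · intro x
      rw [wprod_append, wprod_append, wprod_cons, wprod_nil, one_mul, Module.End.mul_apply,
        Module.End.mul_apply, h2, map_sub, map_smul, refl_refl h, refl_form h]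

lemma form_pos (h : GoodC n d A) {γ : Fin n → ℝ} (hγ : IsRoot n d A γ) :
    0 < formL n d A γ γ := by
  obtain ⟨m, l, h1, -⟩ := root_reflection h hγ
  have : (0:ℝ) < d m := by exact_mod_cast h.hd m
  rw [h1]; linarith

lemma root_ne (h : GoodC n d A) {γ : Fin n → ℝ} (hγ : IsRoot n d A γ) : γ ≠ 0 := by
  rintro rfl
  have := form_pos h hγ
  simp at this

lemma root_refl' (h : GoodC n d A) {γ : Fin n → ℝ} (hγ : IsRoot n d A γ) :
    ∃ (c : ℝ) (l : List (Fin n)), 0 < c ∧ c * formL n d A γ γ = 2 ∧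
      ∀ x, wprod n d A l x = x - (c * formL n d A γ x) • γ := by
  obtain ⟨m, l, h1, h2⟩ := root_reflection h hγ
  have : (0:ℝ) < d m := by exact_mod_cast h.hd m
  refine ⟨_, l, inv_pos.2 this, ?_, h2⟩
  rw [h1]; field_simp

lemma root_neg (h : GoodC n d A) {γ : Fin n → ℝ} (hγ : IsRoot n d A γ) : IsRoot n d A (-γ) := by
  obtain ⟨c, l, hc, h1, h2⟩ := root_refl' h hγ
  have := root_wprod hγ l
  rw [h2, h1] at this
  convert this using 1
  module

lemma pos_refl (h : GoodC n d A) {γ : Fin n → ℝ} (hγ : IsPosRoot n d A γ) (i : Fin n)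
    (hi : ∀ t : ℝ, γ ≠ t • sroot n i) : IsPosRoot n d A (simpleRefl n d A i γ) := by
  have hr := root_refl hγ.1 i
  refine ⟨hr, ?_⟩
  rcases sign_coh h hr with h1 | h1
  · exact h1
  · exfalso
    apply hi (γ i)
    funext k
    by_cases hk : k = i
    · subst hk; simp [sroot]
    · have h2 := h1 k
      rw [refl_coord h i k hk] at h2
      have := hγ.2 k
      simp [sroot, hk]
      linarith

lemma inv_finite (h : GoodC n d A) (l : List (Fin n)) :
    {γ | IsPosRoot n d A γ ∧ ∀ k, wprod n d A l γ k ≤ 0}.Finite := by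
  induction l with
  | nil =>
    convert Set.finite_empty
    ext γ
    simp only [Set.mem_ofPred_eq, Set.mem_empty_iff_false, iff_false, not_and]
    intro hγ h0
    rw [wprod_nil] at h0
    exact root_ne h hγ.1 (funext fun k => le_antisymm (h0 k) (hγ.2 k))
  | cons i l ih =>
    refine ((ih.image (simpleRefl n d A i)).union
      (Set.finite_range fun m : Fin n => Real.sqrt (d m / d i) • sroot n i)).subset ?_
    rintro γ ⟨hγ, h0⟩
    by_cases hi : ∃ t : ℝ, γ = t • sroot n i
    · right
      obtain ⟨t, rfl⟩ := hi
      obtain ⟨m, -, hm, -⟩ := root_reflection h hγ.1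
      refine ⟨m, ?_⟩
      have ht : 0 ≤ t := by simpa [sroot] using hγ.2 i
      have hd : (0:ℝ) < d i := by exact_mod_cast h.hd i
      simp only [map_smul, LinearMap.smul_apply, form_sroot, fco_sroot, h.hdiag, smul_eq_mul] at hm
      have : (d m : ℝ) / d i = t ^ 2 := by
        field_simp; push_cast at hm; linarith
      simp only [this, Real.sqrt_sq ht]
    · push Not at hi
      left
      refine ⟨simpleRefl n d A i γ, ⟨pos_refl h hγ i hi, ?_⟩, refl_refl h i γ⟩
      intro k
      have := h0 k
      rwa [wprod_cons, Module.End.mul_apply] at this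

lemma dual_pair {β γ : Fin n → ℝ} (hi : LinearIndependent ℝ ![β, γ]) :
    ∃ p q : (Fin n → ℝ) →ₗ[ℝ] ℝ, p β = 1 ∧ p γ = 0 ∧ q β = 0 ∧ q γ = 1 := by
  let f : ℝ × ℝ →ₗ[ℝ] (Fin n → ℝ) :=
    (LinearMap.toSpanSingleton ℝ _ β).coprod (LinearMap.toSpanSingleton ℝ _ γ)
  have hf : LinearMap.ker f = ⊥ := by
    rw [LinearMap.ker_eq_bot']
    rintro ⟨a, b⟩ hab
    have := LinearIndependent.pair_iff.1 hi a b (by simpa [f] using hab)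
    simp [this.1, this.2]
  obtain ⟨g, hg⟩ := LinearMap.exists_leftInverse_of_injective f hf
  have h1 : g β = (1, 0) := by
    have := LinearMap.congr_fun hg (1, 0); simpa [f] using this
  have h2 : g γ = (0, 1) := by
    have := LinearMap.congr_fun hg (0, 1); simpa [f] using this
  exact ⟨(LinearMap.fst ℝ ℝ ℝ).comp g, (LinearMap.snd ℝ ℝ ℝ).comp g, by simp [h1], by simp [h2],
    by simp [h1], by simp [h2]⟩

lemma rk2_span {L : Submodule ℝ (Fin n → ℝ)}
    (hL : Module.finrank ℝ L = 2) {β γ : Fin n → ℝ} (hβ : β ∈ L) (hγ : γ ∈ L)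
    (hi : LinearIndependent ℝ ![β, γ]) : L = Submodule.span ℝ {β, γ} := by
  symm
  apply Submodule.eq_of_le_of_finrank_eq
  · rw [Submodule.span_le]
    rintro x (rfl | rfl) <;> assumption
  · have := finrank_span_eq_card hi
    have e : Set.range ![β, γ] = {β, γ} := by
      ext x; simp [eq_comm, or_comm]
    rw [e, Fintype.card_fin] at this
    rw [hL, this]

/-- coordinates in a rank two subspace -/
lemma rk2_coord {L : Submodule ℝ (Fin n → ℝ)}
    (hL : Module.finrank ℝ L = 2) {β γ : Fin n → ℝ} (hβ : β ∈ L) (hγ : γ ∈ L)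
    {p q : (Fin n → ℝ) →ₗ[ℝ] ℝ} (hi : LinearIndependent ℝ ![β, γ])
    (h1 : p β = 1) (h2 : p γ = 0) (h3 : q β = 0) (h4 : q γ = 1) {z : Fin n → ℝ} (hz : z ∈ L) :
    z = p z • β + q z • γ := by
  rw [rk2_span hL hβ hγ hi, Submodule.mem_span_pair] at hz
  obtain ⟨a, b, rfl⟩ := hz
  simp [h1, h2, h3, h4]

lemma exists_other (h : GoodC n d A) {L : Submodule ℝ (Fin n → ℝ)}
    (hL : Module.finrank ℝ L = 2)
    (hsp : Submodule.span ℝ ({γ | IsRoot n d A γ} ∩ (L : Set (Fin n → ℝ))) = L)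
    {β : Fin n → ℝ} (hβ0 : β ≠ 0) :
    ∃ y, IsPosRoot n d A y ∧ y ∈ L ∧ LinearIndependent ℝ ![β, y] := by
  by_contra hcon
  push Not at hcon
  have hcon' : ∀ y, IsRoot n d A y → y ∈ L → y ∈ Submodule.span ℝ {β} := by
    intro y hy hyL
    by_contra hns
    have hli : LinearIndependent ℝ ![β, y] := by
      rw [LinearIndependent.pair_iff' hβ0]
      intro a ha
      exact hns (Submodule.mem_span_singleton.2 ⟨a, ha⟩)
    rcases sign_coh h hy with h1 | h1
    · exact hcon y ⟨hy, h1⟩ hyL hli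
    · refine hcon (-y) ⟨root_neg h hy, fun k => by simpa using h1 k⟩ (L.neg_mem hyL) ?_
      rw [LinearIndependent.pair_iff' hβ0]
      intro a ha
      exact hns (Submodule.mem_span_singleton.2 ⟨-a, by rw [neg_smul, ha, neg_neg]⟩)
  have hle : L ≤ Submodule.span ℝ {β} := by
    rw [← hsp, Submodule.span_le]
    rintro y ⟨h1, h2⟩
    exact hcon' y h1 h2
  have := Submodule.finrank_mono hle
  rw [hL, finrank_span_singleton hβ0] at this
  omega

/-- extremal implies fundamental -/
lemma fund_of_extremal (h : GoodC n d A) {L : Submodule ℝ (Fin n → ℝ)}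
    (hL : Module.finrank ℝ L = 2)
    (hsp : Submodule.span ℝ ({γ | IsRoot n d A γ} ∩ (L : Set (Fin n → ℝ))) = L)
    {β : Fin n → ℝ} (hβ : IsPosRoot n d A β) (hβL : β ∈ L)
    (hext : ∀ x y, IsPosRoot n d A x → IsPosRoot n d A y → x ∈ L → y ∈ L →
      LinearIndependent ℝ ![β, x] → LinearIndependent ℝ ![β, y] →
      ∀ a b : ℝ, 0 < a → 0 < b → β ≠ a • x + b • y) :
    IsFundamentalIn n d A ({γ | IsRoot n d A γ} ∩ (L : Set (Fin n → ℝ))) β := by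
  have hβ0 := root_ne h hβ.1
  obtain ⟨k0, hk0⟩ : ∃ k, 0 < β k := by
    by_contra hcon
    push Not at hcon
    exact hβ0 (funext fun k => le_antisymm (hcon k) (hβ.2 k))
  obtain ⟨y, hy, hyL, hyi⟩ := exists_other h hL hsp hβ0
  -- all positive roots are on one side
  have side : ∀ y, IsPosRoot n d A y → y ∈ L → LinearIndependent ℝ ![β, y] →
      ∀ z, IsPosRoot n d A z → ∀ u v : ℝ, z = u • β + v • y → z ∈ L → 0 ≤ v := by
    intro y hy hyL hyi z hz u v hzv hzL
    by_contra hv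
    push Not at hv
    have hzi : LinearIndependent ℝ ![β, z] := by
      rw [LinearIndependent.pair_iff]
      intro a b hab
      rw [hzv] at hab
      have := LinearIndependent.pair_iff.1 hyi (a + b * u) (b * v) (by rw [← hab]; module)
      have hb : b = 0 := by
        rcases mul_eq_zero.1 this.2 with h | h
        · exact h
        · exact absurd h hv.ne
      refine ⟨?_, hb⟩
      have := this.1
      rw [hb] at this; simpa using this
    have hu : 0 < u := by
      by_contra hu
      push Not at hu
      have hy0 := root_ne h hy.1
      apply hy0
      funext k
      have e := congrFun hzv k
      simp only [Pi.add_apply, Pi.smul_apply, smul_eq_mul] at e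
      have := hz.2 k
      have := hβ.2 k
      have h3 := hy.2 k
      have : v * y k ≤ 0 := by nlinarith
      have : u * β k ≤ 0 := by nlinarith
      have : v * y k = 0 := by linarith
      rcases mul_eq_zero.1 this with h | h
      · exact absurd h hv.ne
      · simpa using h
    refine hext z y hz hy hzL hyL hzi hyi u⁻¹ (-v * u⁻¹) (inv_pos.2 hu)
      (mul_pos (neg_pos.2 hv) (inv_pos.2 hu)) ?_
    rw [hzv]
    have : u ≠ 0 := hu.ne'
    match_scalars
    · field_simp
    · field_simp; ring
  -- choose γ with nonpositive product
  obtain ⟨γ, hγ, hγL, hγi, hform⟩ : ∃ γ, IsPosRoot n d A γ ∧ γ ∈ L ∧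
      LinearIndependent ℝ ![β, γ] ∧ formL n d A β γ ≤ 0 := by
    by_cases hf : formL n d A β y ≤ 0
    · exact ⟨y, hy, hyL, hyi, hf⟩
    push Not at hf
    obtain ⟨c, l, hc, h1, h2⟩ := root_refl' h hβ.1
    have hr := root_wprod hy.1 l
    have hrL : wprod n d A l y ∈ L := by
      rw [h2]; exact L.sub_mem hyL (L.smul_mem _ hβL)
    refine ⟨wprod n d A l y, ⟨hr, ?_⟩, hrL, ?_, ?_⟩
    · rcases sign_coh h hr with h3 | h3
      · exact h3
      · exfalso
        have := side y hy hyL hyi (-wprod n d A l y)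
          ⟨root_neg h hr, fun k => by simpa using h3 k⟩ (c * formL n d A β y) (-1)
          (by rw [h2]; module) (L.neg_mem hrL)
        linarith
    · rw [h2, LinearIndependent.pair_iff]
      intro a b hab
      have := LinearIndependent.pair_iff.1 hyi (a - b * (c * formL n d A β y)) b
        (by rw [← hab]; module)
      obtain ⟨h3, rfl⟩ := this
      exact ⟨by simpa using h3, rfl⟩
    · rw [h2, map_sub, map_smul, smul_eq_mul]
      have : c * formL n d A β y * formL n d A β β = 2 * formL n d A β y := by
        rw [← h1]; ring
      rw [this]; linarith
  obtain ⟨p, q, pβ, pγ, qβ, qγ⟩ := dual_pair hγi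
  have co : ∀ z ∈ L, z = p z • β + q z • γ := fun z hz => rk2_coord hL hβL hγL hγi pβ pγ qβ qγ hz
  have qnn : ∀ z, IsPosRoot n d A z → z ∈ L → 0 ≤ q z := fun z hz hzL =>
    side γ hγ hγL hγi z hz _ _ (co z hzL) hzL
  obtain ⟨c, l, hc, h1, h2⟩ := root_refl' h hγ.1
  have hBfin : {z | IsPosRoot n d A z ∧ z ∈ L ∧ p z ≤ 0}.Finite := by
    refine (inv_finite h l).subset ?_
    rintro z ⟨hz, hzL, hpz⟩
    refine ⟨hz, fun k => ?_⟩
    have e1 : wprod n d A l z = p z • wprod n d A l β + q z • wprod n d A l γ := by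
      conv_lhs => rw [co z hzL]
      simp only [map_add, map_smul]
    rw [e1, h2 β, h2 γ, h1, form_comm h γ β]
    have h3 := hβ.2 k
    have h4 := hγ.2 k
    have h5 := qnn z hz hzL
    simp only [Pi.add_apply, Pi.smul_apply, smul_eq_mul, Pi.sub_apply]
    have h6 : 0 ≤ β k - c * formL n d A β γ * γ k := by
      have : c * formL n d A β γ * γ k ≤ 0 :=
        mul_nonpos_of_nonpos_of_nonneg (mul_nonpos_of_nonneg_of_nonpos hc.le hform) h4
      linarith
    have h7 : p z * (β k - c * formL n d A β γ * γ k) ≤ 0 :=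
      mul_nonpos_of_nonpos_of_nonneg hpz h6
    nlinarith [mul_nonneg h5 h4]
  have qpos : ∀ z, IsPosRoot n d A z → z ∈ L → p z ≤ 0 → 0 < q z := by
    intro z hz hzL hp
    refine lt_of_le_of_ne (qnn z hz hzL) fun h0 => ?_
    apply root_ne h hz.1
    funext k
    have e := congrFun (co z hzL) k
    rw [← h0] at e
    simp only [Pi.add_apply, Pi.smul_apply, smul_eq_mul, zero_mul, add_zero] at e
    have := hz.2 k
    have := hβ.2 k
    have : p z * β k ≤ 0 := mul_nonpos_of_nonpos_of_nonneg hp this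
    simp; linarith
  obtain ⟨δ, ⟨hδ, hδL, hpδ⟩, hmin⟩ := Set.exists_min_image _ (fun z => p z / q z) hBfin
    ⟨γ, hγ, hγL, pγ.le⟩
  have hqδ := qpos δ hδ hδL hpδ
  refine ⟨⟨hβ.1, hβL⟩, hβ, δ, ⟨hδ.1, hδL⟩, hδ, ?_, ?_⟩
  · rintro rfl
    rw [qβ] at hqδ
    exact lt_irrefl _ hqδ
  · rintro z ⟨-, hzL⟩ hz
    refine ⟨p z - q z / q δ * p δ, q z / q δ, ?_, div_nonneg (qnn z hz hzL) hqδ.le, ?_⟩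
    · by_cases hp : p z ≤ 0
      · have h3 : p δ / q δ ≤ p z / q z := hmin z ⟨hz, hzL, hp⟩
        have h4 := qpos z hz hzL hp
        rw [div_le_div_iff₀ hqδ h4] at h3
        rw [sub_nonneg, div_mul_eq_mul_div, div_le_iff₀ hqδ]
        linarith
      · push Not at hp
        have : q z / q δ * p δ ≤ 0 :=
          mul_nonpos_of_nonneg_of_nonpos (div_nonneg (qnn z hz hzL) hqδ.le) hpδ
        linarith
    · conv_lhs => rw [co z hzL]
      conv_rhs => rw [co δ hδL]
      have : q δ ≠ 0 := hqδ.ne'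
      have e1 : p (p δ • β + q δ • γ) = p δ := by rw [← co δ hδL]
      have e2 : q (p δ • β + q δ • γ) = q δ := by rw [← co δ hδL]
      rw [e1, e2]
      match_scalars
      · field_simp; ring
      · field_simp

/-- a cut produces one of finitely many roots -/
lemma cut_finite (h : GoodC n d A) {β : Fin n → ℝ} (hβ : IsPosRoot n d A β) :
    ∃ N : Set (Fin n → ℝ), N.Finite ∧ ∀ R, CutsPerp n d A R β →
      ∃ x ∈ N, x ∈ R ∧ LinearIndependent ℝ ![β, x] := by
  obtain ⟨c, l, hc, h1, h2⟩ := root_refl' h hβ.1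
  refine ⟨_, inv_finite h l, ?_⟩
  rintro R ⟨⟨L, hL, rfl, hsp⟩, hβR, hnf⟩
  by_contra hcon
  push Not at hcon
  apply hnf
  refine fund_of_extremal h hL hsp hβ hβR.2 ?_
  intro x y hx hy hxL hyL hxi hyi a b ha hb hab
  have key : ∀ x, IsPosRoot n d A x → x ∈ L → LinearIndependent ℝ ![β, x] →
      ∀ k, 0 ≤ wprod n d A l x k := by
    intro x hx hxL hxi
    rcases sign_coh h (root_wprod hx.1 l) with h3 | h3
    · exact h3
    · exact absurd hxi (hcon x ⟨hx, h3⟩ ⟨hx.1, hxL⟩)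
  have kx := key x hx hxL hxi
  have ky := key y hy hyL hyi
  apply root_ne h hβ.1
  funext k
  have e : wprod n d A l β k = a * wprod n d A l x k + b * wprod n d A l y k := by
    conv_lhs => rw [hab]
    simp
  rw [h2 β, h1] at e
  simp only [Pi.sub_apply, Pi.smul_apply, smul_eq_mul] at e
  have := hβ.2 k
  have := mul_nonneg ha.le (kx k)
  have := mul_nonneg hb.le (ky k)
  simp; linarith

end helpers2

section helpers3

variable {n : ℕ} {d : Fin n → ℤ} {A : Fin n → Fin n → ℤ}

/-- pairing with `x` -/
def prx {n : ℕ} (x : Fin n → ℝ) : (Fin n → ℝ) →ₗ[ℝ] ℝ := ∑ i : Fin n, x i • LinearMap.proj i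

lemma prx_apply (x θ : Fin n → ℝ) : prx x θ = ∑ i, θ i * x i := by
  simp [prx, LinearMap.sum_apply, mul_comm]

lemma prx_add (x y θ : Fin n → ℝ) : prx (x + y) θ = prx x θ + prx y θ := by
  simp [prx_apply, mul_add, Finset.sum_add_distrib]

lemma prx_smul (a : ℝ) (x θ : Fin n → ℝ) : prx (a • x) θ = a * prx x θ := by
  simp only [prx_apply, Finset.mul_sum, Pi.smul_apply, smul_eq_mul]
  exact Finset.sum_congr rfl fun i _ => by ring

lemma prx_neg (x θ : Fin n → ℝ) : prx (-x) θ = - prx x θ := by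
  simp [prx_apply]

lemma prx_sroot (i : Fin n) (θ : Fin n → ℝ) : prx (sroot n i) θ = θ i := by
  simp [prx_apply, sroot, Pi.single_apply]

lemma prx_dual (i : Fin n) (x θ : Fin n → ℝ) :
    prx x (dualRefl n d A i θ) = prx (simpleRefl n d A i x) θ := by
  have hx : x = ∑ j, x j • sroot n j := by
    funext k; simp [sroot, Finset.sum_apply, Pi.single_apply]
  have e : ∀ k, simpleRefl n d A i x k = ∑ j, x j * simpleRefl n d A i (sroot n j) k := by
    intro k
    conv_lhs => rw [hx]
    simp [map_sum, Finset.sum_apply]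
  simp only [prx_apply, dualRefl, e, Finset.sum_mul, Finset.mul_sum]
  rw [Finset.sum_comm]
  exact Finset.sum_congr rfl fun k _ => Finset.sum_congr rfl fun j _ => by ring

lemma dual_dual (h : GoodC n d A) (i : Fin n) (θ : Fin n → ℝ) :
    dualRefl n d A i (dualRefl n d A i θ) = θ := by
  funext j
  rw [← prx_sroot j (dualRefl n d A i _), prx_dual, prx_dual, refl_refl h, prx_sroot]

lemma dual_coord (h : GoodC n d A) (i : Fin n) (θ : Fin n → ℝ) :
    dualRefl n d A i θ i = - θ i := by
  rw [← prx_sroot i (dualRefl n d A i _), prx_dual, refl_sroot h, prx_neg, prx_sroot]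

/-- dual reflection as a linear equivalence -/
def dualE (h : GoodC n d A) (i : Fin n) : (Fin n → ℝ) ≃ₗ[ℝ] (Fin n → ℝ) :=
  LinearEquiv.ofInvolutive
    { toFun := dualRefl n d A i
      map_add' := fun x y => by
        funext j; simp [dualRefl, add_mul, Finset.sum_add_distrib]
      map_smul' := fun a x => by
        funext j; simp [dualRefl, mul_assoc, Finset.mul_sum] }
    (fun θ => dual_dual h i θ)

lemma dualE_apply (h : GoodC n d A) (i : Fin n) (θ : Fin n → ℝ) :
    dualE h i θ = dualRefl n d A i θ := rfl

/-- dual reflection as a homeomorphism -/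
def dualH (h : GoodC n d A) (i : Fin n) : (Fin n → ℝ) ≃ₜ (Fin n → ℝ) :=
  (dualE h i).toContinuousLinearEquiv.toHomeomorph

lemma dualH_apply (h : GoodC n d A) (i : Fin n) (θ : Fin n → ℝ) :
    dualH h i θ = dualRefl n d A i θ := rfl

lemma mem_shardComplement {β θ : Fin n → ℝ} : θ ∈ shardComplement n d A β ↔
    prx β θ = 0 ∧ ∀ R, CutsPerp n d A R β → ∃ x ∈ R, prx x θ ≠ 0 := by
  simp only [shardComplement, hyperplane, perpSet, prx_apply]
  simp

lemma rankTwo_image (h : GoodC n d A) {R : Set (Fin n → ℝ)} (hR : IsRankTwo n d A R) (i : Fin n) :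
    IsRankTwo n d A (simpleRefl n d A i '' R) := by
  obtain ⟨L, hL, rfl, hsp⟩ := hR
  have hinj : Function.Injective (simpleRefl n d A i) :=
    Function.LeftInverse.injective (refl_refl h i)
  have e : simpleRefl n d A i '' ({γ | IsRoot n d A γ} ∩ (L : Set (Fin n → ℝ)))
      = {γ | IsRoot n d A γ} ∩ ((L.map (simpleRefl n d A i) : Submodule ℝ (Fin n → ℝ)) :
        Set (Fin n → ℝ)) := by
    ext x
    constructor
    · rintro ⟨y, ⟨h1, h2⟩, rfl⟩
      exact ⟨root_refl h1 i, y, h2, rfl⟩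
    · rintro ⟨h1, y, h2, rfl⟩
      refine ⟨y, ⟨?_, h2⟩, rfl⟩
      have := root_refl h1 i
      rwa [refl_refl h] at this
  refine ⟨L.map (simpleRefl n d A i), ?_, e, ?_⟩
  · rw [← hL]
    exact (LinearEquiv.finrank_eq (Submodule.equivMapOfInjective _ hinj L)).symm
  · rw [Submodule.span_image, hsp]

lemma image_image_refl (h : GoodC n d A) (R : Set (Fin n → ℝ)) (i : Fin n) :
    simpleRefl n d A i '' (simpleRefl n d A i '' R) = R := by
  rw [Set.image_image]; simp [refl_refl h]

lemma notMem_image (h : GoodC n d A) {R : Set (Fin n → ℝ)} (hR : IsRankTwo n d A R) (i : Fin n)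
    (hi : sroot n i ∉ R) : sroot n i ∉ simpleRefl n d A i '' R := by
  rintro ⟨x, hx, hx2⟩
  obtain ⟨L, hL, rfl, hsp⟩ := hR
  have : x = - sroot n i := by rw [← refl_sroot h, ← hx2, refl_refl h]
  subst this
  exact hi ⟨root_sroot i, by simpa using L.neg_mem hx.2⟩

lemma fund_image (h : GoodC n d A) {R : Set (Fin n → ℝ)} (hR : IsRankTwo n d A R) (i : Fin n)
    (hi : sroot n i ∉ R) {β : Fin n → ℝ} (hf : IsFundamentalIn n d A R β) :
    IsFundamentalIn n d A (simpleRefl n d A i '' R) (simpleRefl n d A i β) := by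
  have pos : ∀ R, IsRankTwo n d A R → sroot n i ∉ R → ∀ x ∈ R, IsPosRoot n d A x →
      IsPosRoot n d A (simpleRefl n d A i x) := by
    intro R hR hi x hx hxp
    refine pos_refl h hxp i ?_
    rintro t rfl
    obtain ⟨L, hL, rfl, hsp⟩ := hR
    apply hi
    refine ⟨root_sroot i, ?_⟩
    have ht : t ≠ 0 := by
      rintro rfl
      exact root_ne h hxp.1 (by simp)
    exact (L.smul_mem_iff ht).1 hx.2
  obtain ⟨h1, h2, δ, h3, h4, h5, h6⟩ := hf
  refine ⟨⟨β, h1, rfl⟩, pos R hR hi β h1 h2, simpleRefl n d A i δ, ⟨δ, h3, rfl⟩,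
    pos R hR hi δ h3 h4, ?_, ?_⟩
  · intro he
    exact h5 ((Function.LeftInverse.injective (refl_refl h i)) he)
  · rintro γ hγ hγp
    have := pos _ (rankTwo_image h hR i) (notMem_image h hR i hi) γ hγ hγp
    obtain ⟨x, hx, rfl⟩ := hγ
    rw [refl_refl h] at this
    obtain ⟨c, c', hc, hc', rfl⟩ := h6 x hx this
    exact ⟨c, c', hc, hc', by simp⟩

lemma cuts_image (h : GoodC n d A) {R : Set (Fin n → ℝ)} (i : Fin n)
    (hi : sroot n i ∉ R) {β : Fin n → ℝ} (hc : CutsPerp n d A R β) :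
    CutsPerp n d A (simpleRefl n d A i '' R) (simpleRefl n d A i β) := by
  obtain ⟨hR, hβ, hf⟩ := hc
  refine ⟨rankTwo_image h hR i, ⟨β, hβ, rfl⟩, fun hf' => hf ?_⟩
  have := fund_image h (rankTwo_image h hR i) i (notMem_image h hR i hi) hf'
  rwa [image_image_refl h, refl_refl h] at this

lemma key (h : GoodC n d A) {β : Fin n → ℝ} (hβ : IsPosRoot n d A β) (i : Fin n)
    {c : ℝ} (hc : 0 < c) (hcov : simpleRefl n d A i β - β = c • sroot n i)
    (hind : LinearIndependent ℝ ![sroot n i, β]) (θ : Fin n → ℝ) :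
    dualRefl n d A i θ ∈ shardComplement n d A (simpleRefl n d A i β) ↔
      θ ∈ shardComplement n d A β ∧ θ i ≠ 0 := by
  rw [mem_shardComplement, mem_shardComplement, prx_dual, refl_refl h]
  have hsi : simpleRefl n d A i β = β + c • sroot n i := by rw [← hcov]; abel
  constructor
  · rintro ⟨h1, h2⟩
    have hθi : θ i ≠ 0 := by
      intro h0
      let L := Submodule.span ℝ {sroot n i, β}
      have hαL : sroot n i ∈ L := Submodule.subset_span (by simp)
      have hβL : β ∈ L := Submodule.subset_span (by simp)
      have hL : Module.finrank ℝ L = 2 := by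
        have := finrank_span_eq_card hind
        have e : Set.range ![sroot n i, β] = {sroot n i, β} := by
          ext x; simp [eq_comm, or_comm]
        rwa [e, Fintype.card_fin] at this
      have hcut : CutsPerp n d A ({γ | IsRoot n d A γ} ∩ (L : Set (Fin n → ℝ)))
          (simpleRefl n d A i β) := by
        refine ⟨⟨L, hL, rfl, ?_⟩, ⟨root_refl hβ.1 i, ?_⟩, ?_⟩
        · apply le_antisymm
          · rw [Submodule.span_le]; exact Set.inter_subset_right
          · apply Submodule.span_mono
            rintro x (rfl | rfl)
            · exact ⟨root_sroot i, hαL⟩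
            · exact ⟨hβ.1, hβL⟩
        · rw [hsi]; exact L.add_mem hβL (L.smul_mem _ hαL)
        · rintro ⟨-, hp, δ, hδ, hδp, hne, hall⟩
          obtain ⟨a, b, ha, hb, e1⟩ := hall β ⟨hβ.1, hβL⟩ hβ
          obtain ⟨a', b', ha', hb', e2⟩ := hall (sroot n i) ⟨root_sroot i, hαL⟩
            ⟨root_sroot i, fun k => by simp only [sroot, Pi.single_apply]; split_ifs <;> norm_num⟩
          set γ := simpleRefl n d A i β with hγ
          have e3 : γ = (a + c * a') • γ + (b + c * b') • δ := by
            conv_lhs => rw [hsi, e1, e2]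
            module
          -- b' β - b α_i = (b' a - b a') γ
          have e4 : (b' * a - b * a') • γ = b' • β - b • sroot n i := by
            rw [e1, e2]; module
          rw [hsi] at e4
          have e5 := LinearIndependent.pair_iff.1 hind ((b' * a - b * a') * c + b)
            ((b' * a - b * a') - b') (by
              rw [show ((b' * a - b * a') * c + b) • sroot n i + ((b' * a - b * a') - b') • β
                = (b' * a - b * a') • (β + c • sroot n i) - (b' • β - b • sroot n i) by module, e4,
                sub_self])
          have e6 : b' * c + b = 0 := by
            have := e5.1; rw [sub_eq_zero.1 e5.2] at this; exact this
          have hb'0 : b' = 0 := by nlinarith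
          have hb0 : b = 0 := by rw [hb'0] at e6; simpa using e6
          rw [hb0, zero_smul, add_zero, hsi] at e1
          rw [hb'0, zero_smul, add_zero, hsi] at e2
          have e7 := LinearIndependent.pair_iff.1 hind (a * c) (a - 1) (by
            rw [show (a * c) • sroot n i + (a - 1) • β = a • (β + c • sroot n i) - β by module,
              ← e1, sub_self])
          have : a = 1 := by linarith [e7.2]
          rw [this, one_mul] at e7
          exact hc.ne' e7.1
      obtain ⟨x, hx, hx0⟩ := h2 _ hcut
      obtain ⟨a, b, rfl⟩ := Submodule.mem_span_pair.1 hx.2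
      apply hx0
      rw [prx_dual, map_add, map_smul, map_smul, refl_sroot h, hsi, prx_add, prx_smul, prx_smul,
        prx_neg, prx_add, prx_smul, prx_sroot, h1, h0]
      ring
    refine ⟨⟨h1, ?_⟩, hθi⟩
    intro R hR
    by_cases hi : sroot n i ∈ R
    · exact ⟨_, hi, by rwa [prx_sroot]⟩
    · obtain ⟨x, ⟨y, hy, rfl⟩, hx⟩ := h2 _ (cuts_image h i hi hR)
      rw [prx_dual, refl_refl h] at hx
      exact ⟨y, hy, hx⟩
  · rintro ⟨⟨h1, h2⟩, h3⟩
    refine ⟨h1, fun R hR => ?_⟩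
    by_cases hi : sroot n i ∈ R
    · exact ⟨_, hi, by rw [prx_dual, refl_sroot h, prx_neg, prx_sroot]; exact neg_ne_zero.2 h3⟩
    · have := cuts_image h i hi hR
      rw [refl_refl h] at this
      obtain ⟨x, ⟨y, hy, rfl⟩, hx⟩ := h2 _ this
      exact ⟨y, hy, by rwa [prx_dual]⟩

/-- arrangement complement -/
def arrC {n : ℕ} (β : Fin n → ℝ) (F : Set (Fin n → ℝ)) : Set (Fin n → ℝ) :=
  {θ | prx β θ = 0 ∧ ∀ x ∈ F, prx x θ ≠ 0}

/-- a cell of an arrangement -/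
def cellC {n : ℕ} (β : Fin n → ℝ) (F : Set (Fin n → ℝ)) (θ₀ : Fin n → ℝ) : Set (Fin n → ℝ) :=
  {θ | prx β θ = 0 ∧ ∀ x ∈ F, 0 < prx x θ * prx x θ₀}

lemma shard_arr (h : GoodC n d A) {β : Fin n → ℝ} (hβ : IsPosRoot n d A β) :
    ∃ F : Set (Fin n → ℝ), F.Finite ∧ shardComplement n d A β = arrC β F := by
  obtain ⟨N, hN, hcut⟩ := cut_finite h hβ
  refine ⟨{x ∈ N | ∃ R, CutsPerp n d A R β ∧ x ∈ R ∧ LinearIndependent ℝ ![β, x]},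
    hN.subset (fun x hx => hx.1), ?_⟩
  ext θ
  rw [mem_shardComplement]
  constructor
  · rintro ⟨h1, h2⟩
    refine ⟨h1, ?_⟩
    rintro x ⟨hx, R, hR, hxR, hind⟩ h0
    obtain ⟨z, hz, hz0⟩ := h2 R hR
    apply hz0
    obtain ⟨⟨L, hL, rfl, hsp⟩, hβR, -⟩ := hR
    have hzL := hz.2
    rw [rk2_span hL hβR.2 hxR.2 hind] at hzL
    obtain ⟨a, b, rfl⟩ := Submodule.mem_span_pair.1 hzL
    rw [prx_add, prx_smul, prx_smul, h1, h0]; ring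
  · rintro ⟨h1, h2⟩
    refine ⟨h1, fun R hR => ?_⟩
    obtain ⟨x, hxN, hxR, hind⟩ := hcut R hR
    exact ⟨x, hxR, h2 x ⟨hxN, R, hR, hxR, hind⟩⟩

lemma prx_cont (x : Fin n → ℝ) : Continuous (fun θ => prx x θ) :=
  (prx x).continuous_of_finiteDimensional

lemma cell_convex (β : Fin n → ℝ) (F : Set (Fin n → ℝ)) (θ₀ : Fin n → ℝ) :
    Convex ℝ (cellC β F θ₀) := by
  rintro x ⟨hx1, hx2⟩ y ⟨hy1, hy2⟩ a b ha hb hab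
  refine ⟨by simp [hx1, hy1], fun z hz => ?_⟩
  have h1 := hx2 z hz
  have h2 := hy2 z hz
  rw [map_add, map_smul, map_smul, smul_eq_mul, smul_eq_mul, add_mul, mul_assoc, mul_assoc]
  rcases ha.eq_or_lt with rfl | ha
  · have : b = 1 := by linarith
    rw [this]; linarith
  · have := mul_pos ha h1
    have := mul_nonneg hb h2.le
    linarith

lemma mem_cell_self {β : Fin n → ℝ} {F : Set (Fin n → ℝ)} {θ₀ : Fin n → ℝ}
    (h0 : θ₀ ∈ arrC β F) : θ₀ ∈ cellC β F θ₀ :=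
  ⟨h0.1, fun x hx => mul_self_pos.2 (h0.2 x hx)⟩

lemma comp_eq_cell {β : Fin n → ℝ} {F : Set (Fin n → ℝ)} {θ₀ : Fin n → ℝ}
    (h0 : θ₀ ∈ arrC β F) : connectedComponentIn (arrC β F) θ₀ = cellC β F θ₀ := by
  apply Set.Subset.antisymm
  · intro θ hθ
    have hsub := connectedComponentIn_subset (arrC β F) θ₀
    refine ⟨(hsub hθ).1, fun x hx => ?_⟩
    by_contra hcon
    push Not at hcon
    have hpre : IsPreconnected (connectedComponentIn (arrC β F) θ₀) :=
      isPreconnected_connectedComponentIn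
    have him := hpre.image (fun θ => prx x θ * prx x θ₀)
      ((prx_cont x).mul continuous_const).continuousOn
    have hmem0 := mem_connectedComponentIn h0
    have : (0:ℝ) ∈ (fun θ => prx x θ * prx x θ₀) '' connectedComponentIn (arrC β F) θ₀ :=
      him.ordConnected.out ⟨θ, hθ, rfl⟩ ⟨θ₀, hmem0, rfl⟩ ⟨hcon, mul_self_nonneg _⟩
    obtain ⟨η, hη, he⟩ := this
    rcases mul_eq_zero.1 he with h1 | h1
    · exact (hsub hη).2 x hx h1
    · exact h0.2 x hx h1
  · refine (cell_convex β F θ₀).isPreconnected.subset_connectedComponentIn (mem_cell_self h0) ?_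
    rintro θ ⟨h1, h2⟩
    exact ⟨h1, fun x hx h3 => by have := h2 x hx; rw [h3, zero_mul] at this; exact lt_irrefl _ this⟩

lemma cell_congr {β : Fin n → ℝ} {F : Set (Fin n → ℝ)} {θ₀ θ₁ : Fin n → ℝ}
    (h1 : θ₁ ∈ cellC β F θ₀) : cellC β F θ₁ = cellC β F θ₀ := by
  ext θ
  refine and_congr_right fun _ => forall₂_congr fun x hx => ?_
  have := h1.2 x hx
  constructor
  · intro h2
    by_contra hcon
    push Not at hcon
    nlinarith [mul_pos h2 this, mul_self_nonneg (prx x θ₁)]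
  · intro h2
    by_contra hcon
    push Not at hcon
    nlinarith [mul_pos h2 this, mul_self_nonneg (prx x θ₀)]

lemma ker_finrank {β : Fin n → ℝ} (hβ : β ≠ 0) :
    Module.finrank ℝ (LinearMap.ker (prx β)) = n - 1 := by
  have hne : prx β ≠ 0 := by
    intro h0
    apply hβ
    funext k
    have := LinearMap.congr_fun h0 (sroot n k)
    simpa [prx_apply, sroot, Pi.single_apply] using this
  have := Module.Dual.finrank_ker_add_one_of_ne_zero (f := prx β) hne
  simp at this
  omega

lemma cell_span {β : Fin n → ℝ} {F : Set (Fin n → ℝ)} (hF : F.Finite) {θ₀ : Fin n → ℝ}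
    (h0 : θ₀ ∈ arrC β F) :
    Submodule.span ℝ (closure (cellC β F θ₀)) = LinearMap.ker (prx β) := by
  apply le_antisymm
  · rw [Submodule.span_le]
    have hcl : IsClosed {θ : Fin n → ℝ | prx β θ = 0} :=
      isClosed_eq (prx_cont β) continuous_const
    have : closure (cellC β F θ₀) ⊆ {θ : Fin n → ℝ | prx β θ = 0} :=
      closure_minimal (fun θ hθ => hθ.1) hcl
    intro θ hθ
    exact this hθ
  · intro v hv
    have hv : prx β v = 0 := hv
    have hev : ∀ᶠ ε in nhds (0:ℝ), ∀ x ∈ F, 0 < prx x (θ₀ + ε • v) * prx x θ₀ := by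
      rw [Filter.eventually_all_finite hF]
      intro x hx
      have hc : Continuous fun ε : ℝ => prx x (θ₀ + ε • v) * prx x θ₀ := by
        have := prx_cont x
        fun_prop
      have := hc.tendsto 0
      apply this.eventually_const_lt
      simpa using mul_self_pos.2 (h0.2 x hx)
    obtain ⟨ε, hε, hpos⟩ : ∃ ε : ℝ, (∀ x ∈ F, 0 < prx x (θ₀ + ε • v) * prx x θ₀) ∧ 0 < ε := by
      have h1 := (hev.filter_mono nhdsWithin_le_nhds).and
        (self_mem_nhdsWithin (a := (0:ℝ)) (s := Set.Ioi 0))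
      exact h1.exists
    have m1 : θ₀ + ε • v ∈ Submodule.span ℝ (closure (cellC β F θ₀)) :=
      Submodule.subset_span (subset_closure ⟨by simp [h0.1, hv], hε⟩)
    have m2 : θ₀ ∈ Submodule.span ℝ (closure (cellC β F θ₀)) :=
      Submodule.subset_span (subset_closure (mem_cell_self h0))
    have m3 := Submodule.sub_mem _ m1 m2
    rw [add_sub_cancel_left] at m3
    exact (Submodule.smul_mem_iff _ hpos.ne').1 m3

/-- closure of half of a cell -/
lemma closure_half {β : Fin n → ℝ} {F : Set (Fin n → ℝ)} {θ₀ : Fin n → ℝ} (i : Fin n)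
    (h0 : θ₀ ∈ arrC β (insert (sroot n i) F)) :
    closure (cellC β (insert (sroot n i) F) θ₀) =
      closure (cellC β F θ₀) ∩ {θ | 0 ≤ θ i * θ₀ i} := by
  have hins : ∀ θ, θ ∈ cellC β (insert (sroot n i) F) θ₀ ↔
      θ ∈ cellC β F θ₀ ∧ 0 < θ i * θ₀ i := by
    intro θ
    simp only [cellC, Set.mem_ofPred_eq, Set.forall_mem_insert, prx_sroot]
    tauto
  apply Set.Subset.antisymm
  · apply Set.subset_inter
    · exact closure_mono fun θ hθ => ((hins θ).1 hθ).1
    · apply closure_minimal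
      · exact fun θ hθ => ((hins θ).1 hθ).2.le
      · exact isClosed_le continuous_const (by fun_prop)
  · rintro p ⟨hp, hpi⟩
    have hpi : 0 ≤ p i * θ₀ i := hpi
    have hs := (hins θ₀).1 (mem_cell_self h0)
    -- for each t in (0,1], (1-t) p + t θ₀ in closure
    have hmem : ∀ t : ℝ, 0 < t → t < 1 →
        (1 - t) • p + t • θ₀ ∈ closure (cellC β (insert (sroot n i) F) θ₀) := by
      intro t ht ht1
      rw [mem_closure_iff_seq_limit] at hp ⊢
      obtain ⟨u, hu, hlim⟩ := hp
      have hlim2 : Filter.Tendsto (fun k => (1 - t) • u k + t • θ₀) Filter.atTop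
          (nhds ((1 - t) • p + t • θ₀)) := (hlim.const_smul (1 - t)).add_const _
      have hev : ∀ᶠ k in Filter.atTop, 0 < ((1 - t) • u k + t • θ₀) i * θ₀ i := by
        have hc : Continuous fun θ : Fin n → ℝ => θ i * θ₀ i := by fun_prop
        have := (hc.tendsto _).comp hlim2
        apply this.eventually_const_lt
        simp only [Pi.add_apply, Pi.smul_apply, smul_eq_mul]
        nlinarith [mul_nonneg (sub_nonneg.2 ht1.le) hpi, mul_pos ht hs.2]
      obtain ⟨K, hK⟩ := Filter.eventually_atTop.1 hev
      refine ⟨fun k => (1 - t) • u (k + K) + t • θ₀, fun k => ?_,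
        hlim2.comp (Filter.tendsto_add_atTop_nat K)⟩
      rw [hins]
      exact ⟨cell_convex β F θ₀ (hu _) hs.1 (by linarith) ht.le (by ring), hK _ (by omega)⟩
    have hlim : Filter.Tendsto (fun t : ℝ => (1 - t) • p + t • θ₀) (nhdsWithin 0 (Set.Ioi 0))
        (nhds p) := by
      have hc : Continuous fun t : ℝ => (1 - t) • p + t • θ₀ := by fun_prop
      have := hc.tendsto 0
      simp only [sub_zero, one_smul, zero_smul, add_zero] at this
      exact this.mono_left nhdsWithin_le_nhds
    refine isClosed_closure.mem_of_tendsto hlim ?_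
    filter_upwards [Ioo_mem_nhdsGT (zero_lt_one' ℝ)] with t ht
    exact hmem t ht.1 ht.2

lemma finrank_span_image (h : GoodC n d A) (i : Fin n) (S : Set (Fin n → ℝ)) :
    Module.finrank ℝ (Submodule.span ℝ (dualRefl n d A i '' S))
      = Module.finrank ℝ (Submodule.span ℝ S) := by
  have e : dualRefl n d A i '' S = ((dualE h i : (Fin n → ℝ) →ₗ[ℝ] (Fin n → ℝ))) '' S := rfl
  rw [e, Submodule.span_image]
  exact LinearEquiv.finrank_map_eq (dualE h i) _

lemma half_low {β : Fin n → ℝ} (hβ0 : β ≠ 0) (i : Fin n) {k : Fin n} (hk : k ≠ i)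
    (hβk : β k ≠ 0) {S : Set (Fin n → ℝ)} (hS : ∀ θ ∈ S, prx β θ = 0 ∧ θ i = 0) :
    Module.finrank ℝ (Submodule.span ℝ S) ≠ n - 1 := by
  have hlt : Submodule.span ℝ S < LinearMap.ker (prx β) := by
    apply lt_of_le_of_ne
    · rw [Submodule.span_le]; exact fun θ hθ => (hS θ hθ).1
    · intro he
      have hm : β k • sroot n i - β i • sroot n k ∈ LinearMap.ker (prx β) := by
        rw [LinearMap.mem_ker, map_sub, map_smul, map_smul]
        simp [prx_apply, sroot, Pi.single_apply]
        ring
      rw [← he] at hm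
      have hle : Submodule.span ℝ S ≤ LinearMap.ker (prx (sroot n i)) := by
        rw [Submodule.span_le]
        intro θ hθ
        simpa [prx_sroot] using (hS θ hθ).2
      have := hle hm
      rw [LinearMap.mem_ker, prx_sroot] at this
      simp [sroot, hk.symm] at this
      exact hβk this
  have := Submodule.finrank_lt_finrank_of_lt hlt
  rw [ker_finrank hβ0] at this
  exact this.ne

end helpers3

/-- if `β'` is a positive root with `β = s i β'` and
`β - β' ∈ ℝ_{>0} • α i`, then the shards of `β^⊥` are exactly those of the sets
`σ i⁺ K'`, `σ i⁻ K'` (`K'` a shard of `β'^⊥`) whose linear span has dimension `n-1`. -/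
theorem stmt9 (n : ℕ) (hn : 1 ≤ n) (d : Fin n → ℤ) (A : Fin n → Fin n → ℤ)
    (hd : ∀ i, 0 < d i) (hdiag : ∀ i, A i i = 2)
    (hoff : ∀ i j, i ≠ j → A i j ≤ 0)
    (hsym : ∀ i j, d i * A i j = d j * A j i)
    (β' : Fin n → ℝ) (hβ' : IsPosRoot n d A β') (i : Fin n)
    (hcov : ∃ c : ℝ, 0 < c ∧ simpleRefl n d A i β' - β' = c • sroot n i) :
    {K | IsShard n d A (simpleRefl n d A i β') K}
      = {K | (∃ K', IsShard n d A β' K' ∧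
            (K = sigmaOp n d A i true K' ∨ K = sigmaOp n d A i false K'))
          ∧ Module.finrank ℝ (Submodule.span ℝ K) = n - 1} := by
  have h : GoodC n d A := ⟨hd, hdiag, hoff, hsym⟩
  obtain ⟨c, hc, hcov⟩ := hcov
  have hβ0 := root_ne h hβ'.1
  -- a coordinate off `i`
  obtain ⟨k, hk, hβk⟩ : ∃ k, k ≠ i ∧ β' k ≠ 0 := by
    by_contra hcon
    push Not at hcon
    have e : β' = β' i • sroot n i := by
      funext k
      by_cases hk : k = i
      · subst hk; simp [sroot]
      · simp [sroot, hk, hcon k hk]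
    have e2 : simpleRefl n d A i β' = - β' := by
      rw [e, map_smul, refl_sroot h, smul_neg]
    rw [e2] at hcov
    have e3 := congrFun hcov i
    simp [sroot] at e3
    have := hβ'.2 i
    linarith
  have hind : LinearIndependent ℝ ![sroot n i, β'] := by
    rw [LinearIndependent.pair_iff' (root_ne h (root_sroot (d := d) (A := A) i))]
    intro a ha
    apply hβk
    rw [← ha]
    simp [sroot, hk]
  obtain ⟨F, hF, hU⟩ := shard_arr h hβ'
  have hF2 : (insert (sroot n i) F).Finite := hF.insert _
  have hV : shardComplement n d A (simpleRefl n d A i β')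
      = dualH h i '' arrC β' (insert (sroot n i) F) := by
    ext θ
    have hk := key h hβ' i hc hcov hind (dualRefl n d A i θ)
    rw [dual_dual h, hU] at hk
    rw [hk]
    have e : (dualRefl n d A i θ ∈ arrC β' F ∧ dualRefl n d A i θ i ≠ 0) ↔
        dualRefl n d A i θ ∈ arrC β' (insert (sroot n i) F) := by
      simp only [arrC, Set.mem_ofPred_eq, Set.forall_mem_insert, prx_sroot]
      tauto
    rw [e]
    constructor
    · intro hh
      exact ⟨_, hh, by rw [dualH_apply, dual_dual h]⟩
    · rintro ⟨η, hη, rfl⟩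
      rwa [dualH_apply, dual_dual h]
  -- description of the shards of β
  have hS : ∀ K, IsShard n d A (simpleRefl n d A i β') K ↔
      ∃ θ ∈ arrC β' (insert (sroot n i) F),
        K = dualRefl n d A i '' closure (cellC β' (insert (sroot n i) F) θ) := by
    intro K
    have e : ∀ θ ∈ arrC β' (insert (sroot n i) F),
        closure (connectedComponentIn (shardComplement n d A (simpleRefl n d A i β'))
          (dualH h i θ)) =
        dualRefl n d A i '' closure (cellC β' (insert (sroot n i) F) θ) := by
      intro θ hθ
      rw [hV, ← Homeomorph.image_connectedComponentIn _ hθ, comp_eq_cell hθ,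
        ← Homeomorph.image_closure]
      rfl
    constructor
    · rintro ⟨θ, hθ, rfl⟩
      rw [hV] at hθ
      obtain ⟨η, hη, rfl⟩ := hθ
      exact ⟨η, hη, e η hη⟩
    · rintro ⟨η, hη, rfl⟩
      exact ⟨dualH h i η, by rw [hV]; exact ⟨η, hη, rfl⟩, (e η hη).symm⟩
  have hS' : ∀ K, IsShard n d A β' K ↔ ∃ θ ∈ arrC β' F, K = closure (cellC β' F θ) := by
    intro K
    rw [IsShard, hU]
    constructor
    · rintro ⟨θ, hθ, rfl⟩
      exact ⟨θ, hθ, by rw [comp_eq_cell hθ]⟩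
    · rintro ⟨θ, hθ, rfl⟩
      exact ⟨θ, hθ, by rw [comp_eq_cell hθ]⟩
  have hsub : ∀ θ, θ ∈ arrC β' (insert (sroot n i) F) ↔ θ ∈ arrC β' F ∧ θ i ≠ 0 := by
    intro θ
    simp only [arrC, Set.mem_ofPred_eq, Set.forall_mem_insert, prx_sroot]
    tauto
  have hhalf : ∀ θ ∈ arrC β' (insert (sroot n i) F), ∀ ε : Bool,
      (if ε then 0 < θ i else θ i < 0) →
      dualRefl n d A i '' closure (cellC β' (insert (sroot n i) F) θ)
        = sigmaOp n d A i ε (closure (cellC β' F θ)) := by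
    intro θ hθ ε hε
    rw [closure_half i hθ, sigmaOp]
    congr 2
    ext η
    cases ε
    · have hε : θ i < 0 := by simpa using hε
      simp only [Set.mem_ofPred_eq]
      constructor
      · intro hh
        simp only [Bool.false_eq_true, if_false]
        nlinarith
      · intro hh
        simp only [Bool.false_eq_true, if_false] at hh
        nlinarith
    · have hε : 0 < θ i := by simpa using hε
      simp only [Set.mem_ofPred_eq]
      constructor
      · intro hh
        simp only [if_true]
        nlinarith
      · intro hh
        simp only [if_true] at hh
        positivity
  ext K
  simp only [Set.mem_ofPred_eq]
  rw [hS]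
  constructor
  · rintro ⟨θ, hθ, rfl⟩
    refine ⟨⟨closure (cellC β' F θ), (hS' _).2 ⟨θ, ((hsub θ).1 hθ).1, rfl⟩, ?_⟩, ?_⟩
    · rcases lt_or_gt_of_ne ((hsub θ).1 hθ).2 with h1 | h1
      · exact Or.inr (hhalf θ hθ false (by simpa using h1))
      · exact Or.inl (hhalf θ hθ true (by simpa using h1))
    · rw [finrank_span_image h, cell_span hF2 hθ, ker_finrank hβ0]
  · rintro ⟨⟨K', hK', hK⟩, hdim⟩
    obtain ⟨θ, hθ, rfl⟩ := (hS' K').1 hK'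
    obtain ⟨ε, rfl⟩ : ∃ ε, K = sigmaOp n d A i ε (closure (cellC β' F θ)) := by
      rcases hK with h1 | h1
      · exact ⟨_, h1⟩
      · exact ⟨_, h1⟩
    have hex : ∃ η ∈ cellC β' F θ, (if ε then 0 < η i else η i < 0) := by
      by_contra hcon
      push Not at hcon
      rw [sigmaOp, finrank_span_image h] at hdim
      refine half_low hβ0 i hk hβk (S := _) ?_ hdim
      rintro η ⟨hη, hη2⟩
      have hker : closure (cellC β' F θ) ⊆ {η | prx β' η = 0} :=
        closure_minimal (fun _ hh => hh.1) (isClosed_eq (prx_cont β') continuous_const)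
      refine ⟨hker hη, ?_⟩
      cases ε
      · have hcl : closure (cellC β' F θ) ⊆ {η | 0 ≤ η i} :=
          closure_minimal (fun ζ hh => by simpa using hcon ζ hh)
            (isClosed_le continuous_const (by fun_prop))
        have h1 : 0 ≤ η i := hcl hη
        have h2 : η i ≤ 0 := by simpa using hη2
        exact le_antisymm h2 h1
      · have hcl : closure (cellC β' F θ) ⊆ {η | η i ≤ 0} :=
          closure_minimal (fun ζ hh => by simpa using hcon ζ hh)
            (isClosed_le (by fun_prop) continuous_const)
        have h1 : η i ≤ 0 := hcl hη
        have h2 : 0 ≤ η i := by simpa using hη2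
        exact le_antisymm h1 h2
    obtain ⟨η, hη, hε⟩ := hex
    have hηa : η ∈ arrC β' (insert (sroot n i) F) := by
      rw [hsub]
      refine ⟨⟨hη.1, fun x hx h0 => ?_⟩, ?_⟩
      · have := hη.2 x hx
        rw [h0, zero_mul] at this
        exact lt_irrefl _ this
      · cases ε
        · have : η i < 0 := by simpa using hε
          exact this.ne
        · have : 0 < η i := by simpa using hε
          exact this.ne'
    refine ⟨η, hηa, ?_⟩
    rw [hhalf η hηa ε hε, cell_congr hη]

end
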